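/- Let m ≥ 3 and n > 2^(m-1). There is no linear binary code C ⊆ F_2^n with the following property: for every subset S of the coordinate set Fin n with |S| = 2^(m-1), the image of C under the coordinate projection F_2^n → F_2^S is isomorphic (via a bijection between S and the points of F_2^(m-1)) to the code D_m of evaluation vectors of affine functions on F_2^(m-1). -/

import Mathlib

/-- An affine function on a finite `F_2`-space takes the value `1` nowhere, on exactly half of the
points, or everywhere. -/
theorem card_affine_eq_one {V : Type*} [AddCommGroup V] [Module (ZMod 2) V] [Fintype V]
    (ℓ : V →ₗ[ZMod 2] ZMod 2) (c : ZMod 2) :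
    (Finset.univ.filter fun a => ℓ a + c = 1).card = 0 ∨
      2 * (Finset.univ.filter fun a => ℓ a + c = 1).card = Fintype.card V ∨
      (Finset.univ.filter fun a => ℓ a + c = 1).card = Fintype.card V := by
  have dichotomy : ∀ z : ZMod 2, z = 0 ∨ z = 1 := by decide
  by_cases h : ∃ v, ℓ v = 1
  · obtain ⟨v, hv⟩ := h
    right; left
    have translate : (Finset.univ.filter fun a => ℓ a + c = 1).card =
        (Finset.univ.filter fun a => ¬ ℓ a + c = 1).card := by
      refine Finset.card_equiv (Equiv.addRight v) fun a => ?_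
      simp only [Finset.mem_filter, Finset.mem_univ, true_and, Equiv.coe_addRight, map_add, hv]
      generalize ℓ a = z
      revert z c
      decide
    have total := Finset.card_filter_add_card_filter_not (s := (Finset.univ : Finset V))
      (fun a => ℓ a + c = 1)
    rw [Finset.card_univ] at total
    omega
  · have hz : ∀ a, ℓ a = 0 := fun a => (dichotomy (ℓ a)).resolve_right fun h' => h ⟨a, h'⟩
    rcases dichotomy c with rfl | rfl <;> simp [hz]

/-- A word that restricts on `S` to an affine function has weight `0`, `|S| / 2` or `|S|` there. -/
theorem card_filter_eq_one_of_affine {ι V : Type*} [AddCommGroup V] [Module (ZMod 2) V] [Fintype V]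
    {S : Finset ι} (e : {i // i ∈ S} ≃ V) (x : ι → ZMod 2)
    (ℓ : V →ₗ[ZMod 2] ZMod 2) (c : ZMod 2) (hx : ∀ i : {i // i ∈ S}, x i = ℓ (e i) + c) :
    (S.filter fun i => x i = 1).card = 0 ∨ 2 * (S.filter fun i => x i = 1).card = S.card ∨
      (S.filter fun i => x i = 1).card = S.card := by
  have hS : S.card = Fintype.card V := by
    rw [← Fintype.card_coe, Fintype.card_congr e]
  have hw : (S.filter fun i => x i = 1).card =
      (Finset.univ.filter fun a => ℓ a + c = 1).card := by
    refine Finset.card_bij' (fun i hi => e ⟨i, (Finset.mem_filter.1 hi).1⟩)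
      (fun a _ => (e.symm a : ι)) ?_ ?_ ?_ ?_
    · intro i hi
      have := hx ⟨i, (Finset.mem_filter.1 hi).1⟩
      simpa [← this] using (Finset.mem_filter.1 hi).2
    · intro a ha
      have := hx (e.symm a)
      simp_all
    · simp
    · simp
  rw [hw, hS]
  exact card_affine_eq_one ℓ c

/-- For `m ≥ 3` and `n > 2^(m-1)`, there is no binary code `C ⊆ F_2^n` such that
the restriction of `C` to every coordinate subset of size `2^(m-1)` is isomorphic
to the code `D_m` of evaluation vectors of affine functions on `F_2^(m-1)`. -/
theorem stmt_6 (m n : ℕ) (hm : 3 ≤ m) (hn : 2 ^ (m - 1) < n) :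
    ¬ ∃ C : Submodule (ZMod 2) (Fin n → ZMod 2),
      ∀ S : Finset (Fin n), S.card = 2 ^ (m - 1) →
        ∃ e : {i // i ∈ S} ≃ (Fin (m - 1) → ZMod 2),
          { y : {i // i ∈ S} → ZMod 2 | ∃ x ∈ C, ∀ i : {i // i ∈ S}, y i = x i.val } =
          { y | ∃ (ℓ : (Fin (m - 1) → ZMod 2) →ₗ[ZMod 2] ZMod 2) (c : ZMod 2),
              y = fun i => ℓ (e i) + c } := by
  rintro ⟨C, hC⟩
  have weight : ∀ x ∈ C, ∀ S : Finset (Fin n), S.card = 2 ^ (m - 1) →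
      (S.filter fun i => x i = 1).card = 0 ∨ 2 * (S.filter fun i => x i = 1).card = 2 ^ (m - 1) ∨
        (S.filter fun i => x i = 1).card = 2 ^ (m - 1) := by
    intro x hx S hS
    obtain ⟨e, he⟩ := hC S hS
    obtain ⟨ℓ, c, h⟩ := he.subset (show (fun i : {i // i ∈ S} => x i) ∈ _ from ⟨x, hx, fun _ => rfl⟩)
    simpa only [hS] using card_filter_eq_one_of_affine e x ℓ c fun i => congrFun h i
  have four_le : 2 ^ 2 ≤ 2 ^ (m - 1) := Nat.pow_le_pow_right (by norm_num) (by omega)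
  obtain ⟨S, -, hS⟩ := Finset.exists_subset_card_eq
    (s := (Finset.univ : Finset (Fin n))) (n := 2 ^ (m - 1)) (by simpa using hn.le)
  obtain ⟨e, he⟩ := hC S hS
  let k : Fin (m - 1) := ⟨0, by omega⟩
  obtain ⟨x, hx, hxe⟩ := he.superset
    (show (fun i => LinearMap.proj (R := ZMod 2) (φ := fun _ => ZMod 2) k (e i) + 0) ∈ _ from
      ⟨LinearMap.proj k, 0, rfl⟩)
  obtain ⟨p, hpS, hp⟩ : ∃ p ∈ S, x p = 0 :=
    ⟨e.symm 0, (e.symm 0).2, by rw [← hxe]; simp⟩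
  obtain ⟨q, hqS, hq⟩ : ∃ q ∈ S, x q = 1 :=
    ⟨e.symm (Pi.single k 1), (e.symm _).2, by rw [← hxe]; simp⟩
  obtain ⟨j, hj⟩ : ∃ j, j ∉ S := by
    by_contra! h
    rw [Finset.eq_univ_iff_forall.2 h, Finset.card_univ, Fintype.card_fin] at hS
    omega
  have swap_card : ∀ i ∈ S, (insert j (S.erase i)).card = 2 ^ (m - 1) := by
    intro i hi
    rw [Finset.card_insert_of_notMem (by simp [hj]), Finset.card_erase_add_one hi, hS]
  have pos : 0 < (S.filter fun i => x i = 1).card :=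
    Finset.card_pos.2 ⟨q, by simp [hqS, hq]⟩
  have lt : (S.filter fun i => x i = 1).card < 2 ^ (m - 1) := by
    rw [← hS]
    exact Finset.card_lt_card (Finset.filter_ssubset.2 ⟨p, hpS, by simp [hp]⟩)
  have half := weight x hx S hS
  rcases (by decide : ∀ z : ZMod 2, z = 0 ∨ z = 1) (x j) with hxj | hxj
  · have := weight x hx _ (swap_card q hqS)
    rw [Finset.filter_insert, if_neg (by simp [hxj]), Finset.filter_erase,
      Finset.card_erase_of_mem (by simp [hqS, hq])] at this
    omega
  · have := weight x hx _ (swap_card p hpS)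
    rw [Finset.filter_insert, if_pos hxj, Finset.filter_erase,
      Finset.erase_eq_of_notMem (by simp [hp]), Finset.card_insert_of_notMem (by simp [hj])] at this
    omega
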